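/- Let K be a field, t ∈ K^×, and S a set of localities on K such that Assumption (U) holds for S and t. Let S_1, S_2 ⊆ S be nonempty subsets, each compact in the topology T_{Zar*}, such that S_1 and S_2 are t-independent and incomparable. Let z, z′ ∈ K^× be such that z^{−1} ∈ O_w and z′^{−1} ∈ O_w for every valuation ring O_w of K that has a refinement in S_1 and a refinement in S_2. Then there exists b ∈ K^× with b ∈ t·m_v ∩ t·z·m_v for all v ∈ S_1, and b^{−1} ∈ t·m_v ∩ t·z′·m_v for all v ∈ S_2. -/

import Mathlib

namespace PaperApprox

variable {K : Type*} [Field K]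

/-- The "maximal ideal" `m_O = O \ O^×` of a ball `O`, where `O^× = O ∩ O⁻¹` and
`O⁻¹ = {x⁻¹ : 0 ≠ x ∈ O} = {x | x ≠ 0 ∧ x⁻¹ ∈ O}`. -/
def mball (O : Set K) : Set K := O \ (O ∩ {x | x ≠ 0 ∧ x⁻¹ ∈ O})

/-- The scaled set `z·S`. -/
def scale (z : K) (S : Set K) : Set K := {y | ∃ s ∈ S, y = z * s}

/-- A positive cone of a field ordering. -/
def IsOrderingCone (P : Set K) : Prop :=
  (∀ a ∈ P, ∀ b ∈ P, a + b ∈ P) ∧ (∀ a ∈ P, ∀ b ∈ P, a * b ∈ P) ∧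
    (∀ x : K, x ∈ P ∨ -x ∈ P) ∧ ∀ x : K, x ∈ P → -x ∈ P → x = 0

/-- `x ≤_P y` for a positive cone `P`. -/
def coneLE (P : Set K) (a b : K) : Prop := b - a ∈ P

/-- `x <_P y` for a positive cone `P`. -/
def coneLT (P : Set K) (a b : K) : Prop := b - a ∈ P ∧ a ≠ b

/-- The unit interval `{x : -1 ≤_P x ≤_P 1}` of an ordering. -/
def orderingBall (P : Set K) : Set K := {x | x + 1 ∈ P ∧ 1 - x ∈ P}

/-- `O` is the valuation ring of a (Krull) valuation on `K`. -/
def IsValuationLocality (O : Set K) : Prop := ∃ A : ValuationSubring K, O = (A : Set K)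

/-- `O` is the unit interval of a field ordering of `K`. -/
def IsOrderingLocality (O : Set K) : Prop := ∃ P : Set K, IsOrderingCone P ∧ O = orderingBall P

/-- `O` is the closed unit ball of an absolute value on `K`. -/
def IsAbsLocality (O : Set K) : Prop := ∃ f : AbsoluteValue K ℝ, O = {x | f x ≤ 1}

/-- A locality on `K`, identified with its ring/ball `O`. -/
def IsLocality (O : Set K) : Prop := IsValuationLocality O ∨ IsOrderingLocality O ∨ IsAbsLocality O

/-- `W` is the finest common coarsening of the localities `O₁`, `O₂`. -/
def IsFCC (O₁ O₂ W : Set K) : Prop :=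
  IsLocality W ∧ O₁ ⊆ W ∧ O₂ ⊆ W ∧ ∀ W', IsLocality W' → O₁ ⊆ W' → O₂ ⊆ W' → W ⊆ W'

/-- Two subsets `A`, `B` of `W` have the same image in the residue field `W/m_W`. -/
def SameResidue (W A B : Set K) : Prop :=
  (∀ x ∈ A, ∃ y ∈ B, x - y ∈ mball W) ∧ ∀ y ∈ B, ∃ x ∈ A, x - y ∈ mball W

/-- Incomparability of localities. -/
def Incomp (O₁ O₂ : Set K) : Prop := ¬O₁ ⊆ O₂ ∧ ¬O₂ ⊆ O₁

/-- Strong incomparability: incomparable, and the induced localities on the residue field of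
the finest common coarsening are distinct (their rings, i.e. the images of `O₁` and `O₂`,
differ). -/
def StronglyIncomp (O₁ O₂ : Set K) : Prop :=
  Incomp O₁ O₂ ∧ ∀ W, IsFCC O₁ O₂ W → ¬SameResidue W O₁ O₂

/-- `t`-independence of localities. -/
def TIndep (t : K) (O₁ O₂ : Set K) : Prop :=
  (∀ W, IsFCC O₁ O₂ W → t ∈ W ∧ t⁻¹ ∈ W) ∧
    (IsOrderingLocality O₁ → IsOrderingLocality O₂ → StronglyIncomp O₁ O₂)

/-- `t`-independence of valuation rings: `t` and `t⁻¹` lie in the smallest valuation ring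
containing both. -/
def TIndepVal (t : K) (O₁ O₂ : Set K) : Prop :=
  ∀ W : Set K, IsValuationLocality W → O₁ ⊆ W → O₂ ⊆ W →
    (∀ W', IsValuationLocality W' → O₁ ⊆ W' → O₂ ⊆ W' → W ⊆ W') → t ∈ W ∧ t⁻¹ ∈ W

/-- `t`-independence of sets of localities. -/
def SetTIndep (t : K) (S₁ S₂ : Set (Set K)) : Prop := ∀ v ∈ S₁, ∀ w ∈ S₂, TIndep t v w

/-- Incomparability of sets of localities. -/
def SetIncomp (S₁ S₂ : Set (Set K)) : Prop := ∀ v ∈ S₁, ∀ w ∈ S₂, Incomp v w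

/-- Independence of localities: the field topologies they induce on `K` (with the sets
`z·m_v`, `z ∈ K^×`, as neighbourhood bases of `0`) are distinct. -/
def IndepLoc (O₁ O₂ : Set K) : Prop :=
  ¬((∀ z : K, z ≠ 0 → ∃ z' : K, z' ≠ 0 ∧ scale z' (mball O₂) ⊆ scale z (mball O₁)) ∧
     ∀ z : K, z ≠ 0 → ∃ z' : K, z' ≠ 0 ∧ scale z' (mball O₁) ⊆ scale z (mball O₂))

/-- The Zariski topology on localities/balls of `K`. -/
def zarTop (K : Type*) [Field K] : TopologicalSpace (Set K) :=
  TopologicalSpace.generateFrom {U | ∃ x : K, U = {O : Set K | x ∈ O}}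

/-- The Hochster dual of the Zariski topology. -/
def zarStarTop (K : Type*) [Field K] : TopologicalSpace (Set K) :=
  TopologicalSpace.generateFrom {U | ∃ x : K, U = {O : Set K | x ∈ mball O}}

/-- The constructible topology. -/
def conTop (K : Type*) [Field K] : TopologicalSpace (Set K) :=
  TopologicalSpace.generateFrom
    ({U | ∃ x : K, U = {O : Set K | x ∈ O}} ∪ {U | ∃ x : K, U = {O : Set K | x ∈ mball O}})

/-- The Harrison topology on orderings (positive cones) of `K`. -/
def harrisonTop (K : Type*) [Field K] : TopologicalSpace (Set K) :=
  TopologicalSpace.generateFrom {U | ∃ x : K, x ≠ 0 ∧ U = {P : Set K | x ∈ P}}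

/-- Condition (i): `f(O) ⊆ O`. -/
def CondI (f : Polynomial K) (O : Set K) : Prop := ∀ x ∈ O, f.eval x ∈ O

/-- Condition (ii): `f(x) ∉ t·m_O` for `x ∈ O`. -/
def CondII (t : K) (f : Polynomial K) (O : Set K) : Prop := ∀ x ∈ O, f.eval x ∉ scale t (mball O)

/-- Condition (iii): `f(x) ∈ x^d (O \ t·m_O) ∩ (a_d x^d + x^(d-1) O)` for `x ∉ O`. -/
def CondIII (t : K) (f : Polynomial K) (O : Set K) : Prop :=
  ∀ x : K, x ∉ O →
    f.eval x ∈ scale (x ^ f.natDegree) (O \ scale t (mball O)) ∧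
      ∃ u ∈ O, f.eval x = f.leadingCoeff * x ^ f.natDegree + x ^ (f.natDegree - 1) * u

/-- Condition (iv): `O + O ⊆ t⁻¹·O`. -/
def CondIV (t : K) (O : Set K) : Prop := ∀ a ∈ O, ∀ b ∈ O, a + b ∈ scale t⁻¹ O

/-- Assumption (U) for a set `S` of localities and `t ∈ K^×`. -/
def AssumptionU (S : Set (Set K)) (t : K) : Prop :=
  ∃ f : Polynomial K, 2 ≤ f.natDegree ∧
    ∀ v ∈ S, CondI f v ∧ CondII t f v ∧ CondIII t f v ∧ CondIV t v

/-- Assumption (U-exc) for finitely many sets `S 1, …, S n` of localities and `t ∈ K^×`: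
conditions (i), (iii), (iv) everywhere, and condition (ii) on the infinite `S i`. -/
def AssumptionUExc {n : ℕ} (S : Fin n → Set (Set K)) (t : K) : Prop :=
  ∃ f : Polynomial K, 2 ≤ f.natDegree ∧
    (∀ i, ∀ v ∈ S i, CondI f v ∧ CondIII t f v ∧ CondIV t v) ∧
      ∀ i, (S i).Infinite → ∀ v ∈ S i, CondII t f v

/-- `S_π^e(K)`: valuation rings whose value group has a smallest positive element `γ`
(multiplicatively: a largest element `γ < 1`), such that `ℤγ` is convex and
`0 < v(π) ≤ eγ` (multiplicatively `γ^e ≤ v(π) < 1`). -/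
def SPiE (π : K) (e : ℕ) : Set (Set K) :=
  {O | ∃ A : ValuationSubring K, O = (A : Set K) ∧
    ∃ γ : A.ValueGroup, γ ≠ 0 ∧ γ < 1 ∧
      (∀ δ : A.ValueGroup, δ ≠ 0 → δ < 1 → δ ≤ γ) ∧
      (∀ δ : A.ValueGroup, δ ≠ 0 → ∀ m n : ℤ, γ ^ m ≤ δ → δ ≤ γ ^ n → ∃ k : ℤ, δ = γ ^ k) ∧
      A.valuation π < 1 ∧ γ ^ e ≤ A.valuation π}

/-- `O_w` is convex with respect to the ordering with positive cone `P`. -/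
def ConvexWrtOrdering (P W : Set K) : Prop :=
  ∀ u w : K, u ∈ P → w - u ∈ P → w ∈ W → u ∈ W

/-- Iterated application `φ(x₁, φ(x₂, …))`. -/
def iterPhi (φ : K → K → K) : K → List K → K
  | x, [] => x
  | x, y :: l => φ x (iterPhi φ y l)

/-! ### Helper lemmas -/

/-- Basic multiplicative properties shared by all localities. -/
structure Loc (O : Set K) : Prop where
  zero : (0 : K) ∈ O
  one : (1 : K) ∈ O
  mul : ∀ x ∈ O, ∀ y ∈ O, x * y ∈ O
  tot : ∀ x, x ∉ O → x⁻¹ ∈ O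

theorem Loc.mem_mball {O : Set K} (h : Loc O) {x : K} : x ∈ mball O ↔ x = 0 ∨ x⁻¹ ∉ O := by
  unfold mball
  by_cases hx : x = 0
  · simp [hx, h.zero]
  · simp only [Set.mem_sdiff, Set.mem_inter_iff, Set.mem_ofPred_eq, hx, ne_eq, not_false_eq_true,
      true_and, false_or, not_and]
    constructor
    · intro hh
      exact hh.2 hh.1
    · intro hh
      have := h.tot _ hh
      rw [inv_inv] at this
      exact ⟨this, fun _ => hh⟩

theorem mball_sub {O : Set K} {x : K} (hx : x ∈ mball O) : x ∈ O := hx.1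

theorem Loc.mball_mul {O : Set K} (h : Loc O) {x y : K} (hx : x ∈ mball O) (hy : y ∈ O) :
    x * y ∈ mball O := by
  rw [h.mem_mball] at hx ⊢
  by_cases hy0 : y = 0
  · left; simp [hy0]
  rcases hx with hx | hx
  · left; simp [hx]
  · right
    intro hh
    apply hx
    have := h.mul _ hh _ hy
    rwa [mul_inv, mul_assoc, inv_mul_cancel₀ hy0, mul_one] at this

theorem Loc.pow {O : Set K} (h : Loc O) {x : K} (hx : x ∈ O) (n : ℕ) : x ^ n ∈ O := by
  induction n with
  | zero => simpa using h.one
  | succ n ih => rw [pow_succ]; exact h.mul _ ih _ hx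

theorem Loc.inv_mball {O : Set K} (h : Loc O) {x : K} (hx : x ∉ O) : x⁻¹ ∈ mball O := by
  rw [h.mem_mball, inv_inv]; exact Or.inr hx

theorem mem_scale_iff {a x : K} (ha : a ≠ 0) {T : Set K} : x ∈ scale a T ↔ x * a⁻¹ ∈ T := by
  unfold scale
  constructor
  · rintro ⟨s, hs, rfl⟩
    have : a * s * a⁻¹ = s := by field_simp
    rwa [this]
  · intro h
    exact ⟨_, h, by field_simp⟩

theorem Loc.mball_mono {O W : Set K} (h : Loc O) (hW : Loc W) (hs : O ⊆ W) :
    mball W ⊆ mball O := by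
  intro x hx
  rw [hW.mem_mball] at hx
  rw [h.mem_mball]
  exact hx.imp id (fun h1 h2 => h1 (hs h2))

theorem Loc.ofVal (A : ValuationSubring K) : Loc (A : Set K) where
  zero := A.zero_mem
  one := A.one_mem
  mul := fun _ hx _ hy => A.mul_mem _ _ hx hy
  tot := fun x hx => (A.mem_or_inv_mem x).resolve_left hx

theorem Loc.ofAbs (f : AbsoluteValue K ℝ) : Loc {x | f x ≤ 1} where
  zero := by simp
  one := by simp
  mul := fun x hx y hy => by
    simp only [Set.mem_ofPred_eq, map_mul] at *
    exact mul_le_one₀ hx (f.nonneg _) hy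
  tot := fun x hx => by
    simp only [Set.mem_ofPred_eq, map_inv₀, not_le] at *
    exact inv_le_one_of_one_le₀ hx.le

theorem Loc.ofOrd [LinearOrder K] [IsStrictOrderedRing K] : Loc {x : K | |x| ≤ 1} where
  zero := by simp
  one := by simp
  mul := fun x hx y hy => by
    simp only [Set.mem_ofPred_eq, abs_mul] at *
    exact mul_le_one₀ hx (abs_nonneg _) hy
  tot := fun x hx => by
    simp only [Set.mem_ofPred_eq, abs_inv, not_le] at *
    exact inv_le_one_of_one_le₀ hx.le

theorem mball_ord [LinearOrder K] [IsStrictOrderedRing K] {x : K} :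
    x ∈ mball {x : K | |x| ≤ 1} ↔ |x| < 1 := by
  rw [Loc.ofOrd.mem_mball]
  by_cases hx : x = 0
  · simp [hx]
  · have : 0 < |x| := abs_pos.2 hx
    simp only [hx, Set.mem_ofPred_eq, abs_inv, false_or, not_le]
    exact one_lt_inv₀ this

theorem mball_abs (f : AbsoluteValue K ℝ) {x : K} :
    x ∈ mball {x : K | f x ≤ 1} ↔ f x < 1 := by
  rw [(Loc.ofAbs f).mem_mball]
  by_cases hx : x = 0
  · simp [hx]
  · have : 0 < f x := f.pos hx
    simp only [hx, Set.mem_ofPred_eq, map_inv₀, false_or, not_le]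
    exact one_lt_inv₀ this

theorem ord_linear {O : Set K} (h : IsOrderingLocality O) :
    ∃ (l : LinearOrder K) (_ : IsStrictOrderedRing K), O = {x : K | |x| ≤ 1} := by
  classical
  obtain ⟨P, ⟨hadd, hmul, htot, hanti⟩, rfl⟩ := h
  have h0 : (0 : K) ∈ P := by rcases htot 0 with h | h <;> simpa using h
  have h1 : (1 : K) ∈ P := by
    rcases htot 1 with h | h
    · exact h
    · simpa using hmul _ h _ h
  let l : LinearOrder K :=
    { le := fun a b => b - a ∈ P
      le_refl := fun a => by simpa using h0
      le_trans := fun a b c hab hbc => by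
        have := hadd _ hab _ hbc
        have e : b - a + (c - b) = c - a := by ring
        rwa [e] at this
      le_antisymm := fun a b hab hba => by
        have := hanti _ hab (by simpa using hba)
        exact (sub_eq_zero.1 this).symm
      le_total := fun a b => by
        rcases htot (b - a) with h | h
        · exact Or.inl h
        · right; simpa using h
      toDecidableLE := Classical.decRel _ }
  have hle : ∀ a b : K, a ≤ b ↔ b - a ∈ P := fun a b => Iff.rfl
  have : IsOrderedAddMonoid K :=
    { add_le_add_left := fun a b hab c => by
        rw [hle] at *
        simpa using hab }
  have : ZeroLEOneClass K := ⟨by rw [hle]; simpa using h1⟩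
  have : IsOrderedRing K := .of_mul_nonneg (fun x y hx hy => by
    rw [hle] at *
    simpa using hmul _ (by simpa using hx) _ (by simpa using hy))
  refine ⟨l, IsOrderedRing.toIsStrictOrderedRing K, ?_⟩
  ext x
  change x + 1 ∈ P ∧ 1 - x ∈ P ↔ |x| ≤ 1
  rw [abs_le, hle, hle, sub_neg_eq_add]

theorem IsLocality.loc {O : Set K} (h : IsLocality O) : Loc O := by
  rcases h with ⟨A, rfl⟩ | h | ⟨f, rfl⟩
  · exact Loc.ofVal A
  · obtain ⟨l, hl, rfl⟩ := ord_linear h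
    exact Loc.ofOrd
  · exact Loc.ofAbs f

/-- An absolute value bounded on `ℕ` has a valuation ring as unit ball. -/
theorem abs_bdd_val (f : AbsoluteValue K ℝ) (h : ∀ n : ℕ, f n ≤ 1) :
    IsValuationLocality {x | f x ≤ 1} := by
  have key : ∀ x y : K, f x ≤ 1 → f y ≤ 1 → f (x + y) ≤ 1 := by
    intro x y hx hy
    by_contra hlt
    push Not at hlt
    have hb : ∀ n : ℕ, f (x + y) ^ n ≤ n + 1 := by
      intro n
      rw [← map_pow, add_pow]
      refine (f.sum_le _ _).trans ?_
      calc _ ≤ ∑ i ∈ Finset.range (n + 1), (1 : ℝ) := by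
            apply Finset.sum_le_sum
            intro i _
            rw [map_mul, map_mul, map_pow, map_pow]
            refine mul_le_one₀ (mul_le_one₀ (pow_le_one₀ (f.nonneg _) hx)
              (pow_nonneg (f.nonneg _) _) (pow_le_one₀ (f.nonneg _) hy)) (f.nonneg _) (h _)
        _ = n + 1 := by simp
    obtain ⟨δ, hδ⟩ : ∃ δ, δ = f (x + y) - 1 := ⟨_, rfl⟩
    have hδ0 : 0 < δ := by linarith
    obtain ⟨n, hn⟩ := exists_nat_gt (3 / δ ^ 2 + 1)
    have hn1 : (1 : ℝ) < n := by
      have : 0 < 3 / δ ^ 2 := by positivity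
      linarith
    have hn3 : 3 < n * δ ^ 2 := by
      have : 3 / δ ^ 2 < n := by linarith
      rwa [div_lt_iff₀ (by positivity)] at this
    have b1 := one_add_mul_le_pow (show (-2 : ℝ) ≤ δ by linarith) n
    have b2 := hb (n * 2)
    rw [pow_mul] at b2
    have e : f (x + y) = 1 + δ := by linarith
    rw [e] at b2
    have b3 : (n * δ) ^ 2 ≤ ((1 + δ) ^ n) ^ 2 := by
      apply pow_le_pow_left₀ (by positivity)
      linarith
    push_cast at b2
    nlinarith
  refine ⟨{ carrier := {x | f x ≤ 1}, mul_mem' := ?_, one_mem' := ?_, add_mem' := ?_,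
            zero_mem' := ?_, neg_mem' := ?_, mem_or_inv_mem' := ?_ }, rfl⟩
  · intro a b ha hb
    exact (Loc.ofAbs f).mul _ ha _ hb
  · exact (Loc.ofAbs f).one
  · intro a b ha hb
    exact key _ _ ha hb
  · exact (Loc.ofAbs f).zero
  · intro a ha
    simpa using ha
  · intro x
    by_cases hx : f x ≤ 1
    · exact Or.inl hx
    · exact Or.inr ((Loc.ofAbs f).tot _ hx)

/-- `A` is the smallest valuation ring containing the locality `O`. -/
structure IsHull (O : Set K) (A : ValuationSubring K) : Prop where
  sub : O ⊆ A
  alt : O = A ∨ ∃ N : ℕ, (N : K) ∉ O ∧ ∀ a ∈ A, ∃ n : ℕ, a / (N : K) ^ n ∈ O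

theorem IsHull.min {O : Set K} {A : ValuationSubring K} (h : IsHull O A) (hO : Loc O)
    {C : ValuationSubring K} (hC : O ⊆ C) : A ≤ C := by
  intro a ha
  rcases h.alt with h1 | ⟨N, hN, h1⟩
  · apply hC; rw [h1]; exact ha
  · obtain ⟨n, hn⟩ := h1 a ha
    have hN0 : (N : K) ≠ 0 := by
      intro h0; rw [h0] at hN; exact hN hO.zero
    have e : a = a / (N : K) ^ n * (N : K) ^ n := by field_simp
    rw [e]
    exact C.mul_mem _ _ (hC hn) (pow_mem (natCast_mem C N) n)

theorem hull_ord [LinearOrder K] [IsStrictOrderedRing K] :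
    ∃ A, IsHull {x : K | |x| ≤ 1} A := by
  let A : ValuationSubring K :=
    { carrier := {x | ∃ n : ℕ, |x| ≤ n}
      mul_mem' := by
        rintro a b ⟨n, hn⟩ ⟨m, hm⟩
        refine ⟨n * m, ?_⟩
        rw [abs_mul]; push_cast
        exact mul_le_mul hn hm (abs_nonneg _) (Nat.cast_nonneg _)
      one_mem' := ⟨1, by simp⟩
      add_mem' := by
        rintro a b ⟨n, hn⟩ ⟨m, hm⟩
        refine ⟨n + m, (abs_add_le _ _).trans ?_⟩
        push_cast
        exact add_le_add hn hm
      zero_mem' := ⟨0, by simp⟩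
      neg_mem' := by
        rintro a ⟨n, hn⟩
        exact ⟨n, by simpa using hn⟩
      mem_or_inv_mem' := by
        intro x
        by_cases hx : |x| ≤ 1
        · exact Or.inl ⟨1, by simpa using hx⟩
        · exact Or.inr ⟨1, by simpa using Loc.ofOrd.tot x hx⟩ }
  refine ⟨A, fun x hx => ⟨1, by simpa using hx⟩, Or.inr ⟨2, ?_, ?_⟩⟩
  · simp
  · rintro a ⟨n, hn⟩
    refine ⟨n, ?_⟩
    simp only [Set.mem_ofPred_eq, abs_div, abs_pow]
    have h2 : (0 : K) < |((2 : ℕ) : K)| ^ n := by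
      apply pow_pos; simp
    rw [div_le_one h2]
    refine hn.trans ?_
    have : n < 2 ^ n := Nat.lt_two_pow_self
    simp only [Nat.cast_ofNat, abs_two]
    exact_mod_cast this.le

theorem hull_exists {O : Set K} (h : IsLocality O) : ∃ A, IsHull O A := by
  rcases h with ⟨A, rfl⟩ | h | ⟨f, rfl⟩
  · exact ⟨A, subset_rfl, Or.inl rfl⟩
  · obtain ⟨l, hl, rfl⟩ := ord_linear h
    exact hull_ord
  · by_cases hf : ∀ n : ℕ, f n ≤ 1
    · obtain ⟨A, hA⟩ := abs_bdd_val f hf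
      exact ⟨A, hA.subset, Or.inl hA⟩
    · push Not at hf
      obtain ⟨N, hN⟩ := hf
      refine ⟨⊤, fun x _ => trivial, Or.inr ⟨N, by simpa using hN, fun a _ => ?_⟩⟩
      obtain ⟨n, hn⟩ := pow_unbounded_of_one_lt (f a) hN
      refine ⟨n, ?_⟩
      simp only [Set.mem_ofPred_eq, map_div₀, map_pow]
      rw [div_le_one (by positivity)]
      exact hn.le

/-- The product of two valuation rings. -/
def prodVal (A B : ValuationSubring K) : ValuationSubring K where
  carrier := {x | ∃ a ∈ A, ∃ b ∈ B, x = a * b}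
  mul_mem' := by
    rintro _ _ ⟨a, ha, b, hb, rfl⟩ ⟨c, hc, d, hd, rfl⟩
    exact ⟨a * c, A.mul_mem _ _ ha hc, b * d, B.mul_mem _ _ hb hd, by ring⟩
  one_mem' := ⟨1, A.one_mem, 1, B.one_mem, by simp⟩
  zero_mem' := ⟨0, A.zero_mem, 0, B.zero_mem, by simp⟩
  neg_mem' := by
    rintro _ ⟨a, ha, b, hb, rfl⟩
    exact ⟨-a, A.neg_mem _ ha, b, hb, by ring⟩
  add_mem' := by
    have key : ∀ a ∈ A, ∀ b ∈ B, ∀ c ∈ A, ∀ d ∈ B, d ≠ 0 → b / d ∈ A →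
        ∃ x ∈ A, ∃ y ∈ B, a * b + c * d = x * y := by
      intro a ha b hb c hc d hd h0 h
      exact ⟨a * (b / d) + c, A.add_mem _ _ (A.mul_mem _ _ ha h) hc, d, hd, by field_simp⟩
    rintro _ _ ⟨a, ha, b, hb, rfl⟩ ⟨c, hc, d, hd, rfl⟩
    by_cases hd0 : d = 0
    · exact ⟨a, ha, b, hb, by simp [hd0]⟩
    by_cases hb0 : b = 0
    · exact ⟨c, hc, d, hd, by simp [hb0]⟩
    rcases A.mem_or_inv_mem (b / d) with h | h
    · exact key a ha b hb c hc d hd hd0 h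
    · rw [inv_div] at h
      rw [Set.mem_ofPred_eq, add_comm]
      exact key c hc d hd a ha b hb hb0 h
  mem_or_inv_mem' := by
    intro x
    rcases A.mem_or_inv_mem x with h | h
    · exact Or.inl ⟨x, h, 1, B.one_mem, by simp⟩
    · exact Or.inr ⟨_, h, 1, B.one_mem, by simp⟩

theorem mem_prodVal {A B : ValuationSubring K} {x : K} :
    x ∈ prodVal A B ↔ ∃ a ∈ A, ∃ b ∈ B, x = a * b := Iff.rfl

theorem le_prodVal_left (A B : ValuationSubring K) : A ≤ prodVal A B :=
  fun x hx => ⟨x, hx, 1, B.one_mem, by simp⟩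

theorem le_prodVal_right (A B : ValuationSubring K) : B ≤ prodVal A B :=
  fun x hx => ⟨1, A.one_mem, x, hx, by simp⟩

/-- A locality contained in a locality that is not a valuation ring is equal to it. -/
theorem sub_of_nonval {O W : Set K} (hO : IsLocality O) (hW : IsLocality W)
    (hnv : ¬IsValuationLocality W) (hs : O ⊆ W) : W ⊆ O := by
  intro x hxW
  by_contra hxO
  have hO' := hO.loc
  have hxi : x⁻¹ ∈ O := hO'.tot _ hxO
  have hx0 : x ≠ 0 := by rintro rfl; exact hxO hO'.zero
  rcases hW with hW | hW | ⟨g, rfl⟩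
  · exact hnv hW
  · obtain ⟨l, hl, rfl⟩ := ord_linear hW
    have h1 : |x| ≤ 1 := hxW
    have h2 : |x⁻¹| ≤ 1 := hs hxi
    rw [abs_inv] at h2
    have h3 : 1 ≤ |x| := (inv_le_one₀ (abs_pos.2 hx0)).1 h2
    have h4 : |x| = 1 := le_antisymm h1 h3
    rcases eq_or_eq_neg_of_abs_eq h4 with h | h
    · exact hxO (h ▸ hO'.one)
    · by_cases h' : (-1 : K) ∈ O
      · exact hxO (h ▸ h')
      · have := hO'.tot _ h'
        rw [show (-1 : K)⁻¹ = -1 by norm_num] at this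
        exact h' this
  · have hN : ∃ N : ℕ, 1 < g N := by
      by_contra hh
      push Not at hh
      exact hnv (abs_bdd_val g hh)
    obtain ⟨N, hN⟩ := hN
    have hgx : g x ≤ 1 := hxW
    have hgx' : g x⁻¹ ≤ 1 := hs hxi
    have hfin : ∀ k : ℕ, (N : K) * (x⁻¹) ^ k ∉ O := by
      intro k hk
      have h1 : g ((N : K) * (x⁻¹) ^ k) ≤ 1 := hs hk
      have hgx1 : g x⁻¹ = 1 := by
        apply le_antisymm hgx'
        rw [map_inv₀]
        exact (one_le_inv₀ (g.pos hx0)).2 hgx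
      rw [map_mul, map_pow, hgx1, one_pow, mul_one] at h1
      linarith
    rcases hO with ⟨A, rfl⟩ | hO | ⟨f, rfl⟩
    · have : g N ≤ 1 := hs (natCast_mem A N)
      linarith
    · obtain ⟨l, hl, rfl⟩ := ord_linear hO
      have hx1 : 1 < |x| := not_le.1 hxO
      obtain ⟨δ, hδ⟩ : ∃ δ, δ = |x| - 1 := ⟨_, rfl⟩
      have hδ0 : 0 < δ := by rw [hδ]; linarith
      have hk : ∃ k : ℕ, 1 < δ * (N : K) ^ k := by
        by_contra hh
        push Not at hh
        have hb : ∀ k : ℕ, g δ * g N ^ k ≤ 1 := by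
          intro k
          have : δ * (N : K) ^ k ∈ {x : K | |x| ≤ 1} := by
            have h0 : 0 ≤ δ * (N : K) ^ k := by positivity
            change |_| ≤ 1
            rw [abs_of_nonneg h0]
            exact hh k
          have := hs this
          simpa using this
        have hg0 : 0 < g δ := g.pos hδ0.ne'
        obtain ⟨n, hn⟩ := pow_unbounded_of_one_lt ((g δ)⁻¹) hN
        have := hb n
        rw [inv_lt_iff_one_lt_mul₀ hg0] at hn
        linarith
      obtain ⟨k, hk⟩ := hk
      apply hfin (N * N ^ k)
      change |_| ≤ 1
      rw [abs_mul, abs_pow, abs_inv, inv_pow, Nat.abs_cast, ← div_eq_mul_inv,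
        div_le_one (by positivity)]
      have b1 := one_add_mul_le_pow (show (-2 : K) ≤ δ by linarith) (N * N ^ k)
      have e : |x| = 1 + δ := by rw [hδ]; ring
      rw [e]
      refine le_trans ?_ b1
      push_cast
      have : (0 : K) ≤ N := by positivity
      nlinarith
    · have hx1 : 1 < f x := not_le.1 hxO
      obtain ⟨n, hn⟩ := pow_unbounded_of_one_lt (f N) hx1
      apply hfin n
      change f _ ≤ 1
      rw [map_mul, map_pow, map_inv₀, inv_pow, ← div_eq_mul_inv, div_le_one (by positivity)]
      exact hn.le

theorem fcc_prodVal {O₁ O₂ : Set K} (h₁ : IsLocality O₁) (h₂ : IsLocality O₂)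
    (hinc : Incomp O₁ O₂) {A B : ValuationSubring K} (hA : IsHull O₁ A) (hB : IsHull O₂ B) :
    IsFCC O₁ O₂ (prodVal A B : Set K) := by
  refine ⟨Or.inl ⟨_, rfl⟩, fun x hx => le_prodVal_left A B (hA.sub hx),
    fun x hx => le_prodVal_right A B (hB.sub hx), ?_⟩
  intro W hW hs1 hs2
  by_cases hv : IsValuationLocality W
  · obtain ⟨C, rfl⟩ := hv
    rintro x ⟨a, ha, b, hb, rfl⟩
    exact C.mul_mem _ _ (hA.min h₁.loc hs1 ha) (hB.min h₂.loc hs2 hb)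
  · exact absurd (hs2.trans (sub_of_nonval h₁ hW hv hs1)) hinc.2

/-- Generic independence argument. -/
theorem pair_generic {O₁ O₂ : Set K} (h₁ : Loc O₁) (h₂ : Loc O₂) (hinc : Incomp O₁ O₂)
    {s s' : K} (hs : ∃ a ∈ O₁, ∃ u ∈ O₂, s = a * u) (hs' : ∃ a ∈ O₁, ∃ u ∈ O₂, s' = a * u) :
    ∃ b : K, b ≠ 0 ∧ b * s ∈ mball O₁ ∧ b⁻¹ * s' ∈ mball O₂ := by
  -- an element `y ∈ Q \ P` that dominates `u` in `P`
  have dom : ∀ P Q : Set K, Loc P → Loc Q → ¬Q ⊆ P → ∀ u ∈ Q, ∃ y ∈ Q, y ∉ P ∧ u * y⁻¹ ∈ P := by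
    intro P Q hP hQ hne u hu
    obtain ⟨y, hy, hyP⟩ := Set.not_subset.1 hne
    by_cases h : u * y⁻¹ ∈ P
    · exact ⟨y, hy, hyP, h⟩
    · have hu0 : u ≠ 0 := by rintro rfl; apply h; simpa using hP.zero
      refine ⟨u, hu, ?_, by rw [mul_inv_cancel₀ hu0]; exact hP.one⟩
      intro huP
      exact h (hP.mul _ huP _ (hP.tot _ hyP))
  obtain ⟨a, ha, u, hu, rfl⟩ := hs
  obtain ⟨a', ha', u', hu', rfl⟩ := hs'
  obtain ⟨y, hy2, hy1, huy⟩ := dom O₁ O₂ h₁ h₂ hinc.2 u hu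
  obtain ⟨x, hx1, hx2, hax⟩ := dom O₂ O₁ h₂ h₁ hinc.1 a' ha'
  have hx0 : x ≠ 0 := by rintro rfl; exact hx2 h₂.zero
  have hy0 : y ≠ 0 := by rintro rfl; exact hy1 h₁.zero
  refine ⟨x ^ 2 * (y ^ 2)⁻¹, by positivity, ?_, ?_⟩
  · have e : x ^ 2 * (y ^ 2)⁻¹ * (a * u) = y⁻¹ * ((u * y⁻¹) * (x ^ 2 * a)) := by
      field_simp
    rw [e]
    exact h₁.mball_mul (h₁.inv_mball hy1) (h₁.mul _ huy _ (h₁.mul _ (h₁.pow hx1 2) _ ha))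
  · have e : (x ^ 2 * (y ^ 2)⁻¹)⁻¹ * (a' * u') = x⁻¹ * ((a' * x⁻¹) * (y ^ 2 * u')) := by
      field_simp
    rw [e]
    exact h₂.mball_mul (h₂.inv_mball hx2) (h₂.mul _ hax _ (h₂.mul _ (h₂.pow hy2 2) _ hu'))

/-- topological nilpotence -/
def TN (O : Set K) (A : ValuationSubring K) (y : K) : Prop :=
  ∀ a ∈ A, ∃ k₀ : ℕ, ∀ k ≥ k₀, y ^ k * a ∈ mball O

theorem tn_abs (f : AbsoluteValue K ℝ) (A : ValuationSubring K) {y : K}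
    (hy : y ∈ mball {x | f x ≤ 1}) : TN {x | f x ≤ 1} A y := by
  intro a _
  rw [mball_abs] at hy
  obtain ⟨n, hn⟩ := exists_pow_lt_of_lt_one (show (0 : ℝ) < (f a + 1)⁻¹ by
    have := f.nonneg a; positivity) hy
  refine ⟨n, fun k hk => ?_⟩
  rw [mball_abs, map_mul, map_pow]
  have h1 : f y ^ k ≤ f y ^ n := pow_le_pow_of_le_one (f.nonneg _) hy.le hk
  have h2 := f.nonneg a
  have h3 : f y ^ k < (f a + 1)⁻¹ := h1.trans_lt hn
  have h4 : f y ^ k * (f a + 1) < 1 := by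
    have h6 : 0 < f a + 1 := by positivity
    rwa [← one_div, lt_div_iff₀ h6] at h3
  have h5 : 0 ≤ f y ^ k := pow_nonneg (f.nonneg _) _
  nlinarith

theorem tn_ord_top [LinearOrder K] [IsStrictOrderedRing K] {A : ValuationSubring K} {y : K}
    (N : ℕ) (hN : ∀ a : K, ∃ n : ℕ, a / (N : K) ^ n ∈ {x : K | |x| ≤ 1})
    (hN0 : (N : K) ≠ 0)
    (hy : y ∈ mball {x : K | |x| ≤ 1}) : TN {x : K | |x| ≤ 1} A y := by
  have hbd : ∀ a : K, ∃ n : ℕ, |a| ≤ n := by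
    intro a
    obtain ⟨n, hn⟩ := hN a
    have hn : |a / (N : K) ^ n| ≤ 1 := hn
    rw [abs_div, abs_pow, Nat.abs_cast, div_le_one (by positivity)] at hn
    exact ⟨N ^ n, by exact_mod_cast hn⟩
  have : Archimedean K := archimedean_iff_nat_le.2 fun x => by
    obtain ⟨n, hn⟩ := hbd x
    exact ⟨n, (le_abs_self x).trans hn⟩
  intro a _
  rw [mball_ord] at hy
  obtain ⟨n, hn⟩ := exists_pow_lt_of_lt_one (show (0 : K) < (|a| + 1)⁻¹ by positivity) hy
  refine ⟨n, fun k hk => ?_⟩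
  rw [mball_ord, abs_mul, abs_pow]
  have h1 : |y| ^ k ≤ |y| ^ n := pow_le_pow_of_le_one (abs_nonneg _) hy.le hk
  have h2 := abs_nonneg a
  have h3 : |y| ^ k < (|a| + 1)⁻¹ := h1.trans_lt hn
  have h4 : |y| ^ k * (|a| + 1) < 1 := by
    have h6 : 0 < |a| + 1 := by positivity
    rwa [← one_div, lt_div_iff₀ h6] at h3
  have h5 : 0 ≤ |y| ^ k := pow_nonneg (abs_nonneg _) _
  nlinarith

theorem tn_ord [LinearOrder K] [IsStrictOrderedRing K] {A : ValuationSubring K}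
    (N : ℕ) (hN : ∀ a ∈ A, ∃ n : ℕ, a / (N : K) ^ n ∈ {x : K | |x| ≤ 1})
    (hN0 : (N : K) ≠ 0) {x : K} (hx : |x| ≤ 1) (m : ℕ) :
    TN {x : K | |x| ≤ 1} A (x / (1 + ((m : K) + 1)⁻¹)) := by
  intro a ha
  obtain ⟨n, hn⟩ := hN a ha
  have hn : |a / (N : K) ^ n| ≤ 1 := hn
  rw [abs_div, abs_pow, Nat.abs_cast, div_le_one (by positivity)] at hn
  refine ⟨(m + 1) * N ^ n, fun k hk => ?_⟩
  have hr : (0 : K) < 1 + ((m : K) + 1)⁻¹ := by positivity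
  rw [mball_ord, abs_mul, abs_pow, abs_div, abs_of_pos hr, div_pow, div_mul_eq_mul_div,
    div_lt_one (by positivity)]
  have b1 := one_add_mul_le_pow (show (-2 : K) ≤ ((m : K) + 1)⁻¹ by
    have : (0 : K) < ((m : K) + 1)⁻¹ := by positivity
    linarith) k
  refine lt_of_lt_of_le ?_ b1
  have hk' : ((m : K) + 1) * (N : K) ^ n ≤ k := by exact_mod_cast hk
  have h1 : (N : K) ^ n ≤ k * ((m : K) + 1)⁻¹ := by
    rw [← div_eq_mul_inv, le_div_iff₀ (by positivity)]
    linarith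
  have h2 : |x| ^ k * |a| ≤ 1 * |a| :=
    mul_le_mul_of_nonneg_right (pow_le_one₀ (abs_nonneg _) hx) (abs_nonneg _)
  linarith

theorem tn_ord_inv [LinearOrder K] [IsStrictOrderedRing K] {A : ValuationSubring K}
    (N : ℕ) (hN : ∀ a ∈ A, ∃ n : ℕ, a / (N : K) ^ n ∈ {x : K | |x| ≤ 1})
    (hN0 : (N : K) ≠ 0) {x : K} (hx : ∀ y ∈ {x : K | |x| ≤ 1}, x - y ∉ mball (A : Set K)) :
    ∃ m : ℕ, TN {x : K | |x| ≤ 1} A (x / (1 + ((m : K) + 1)⁻¹))⁻¹ := by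
  have hA := Loc.ofVal A
  have hx1 : 1 < |x| := by
    by_contra h
    apply hx x (not_lt.1 h)
    rw [sub_self, hA.mem_mball]
    exact Or.inl rfl
  have hδ : (|x| - 1)⁻¹ ∈ A := by
    by_contra hδ
    have hm : |x| - 1 ∈ mball (A : Set K) := by
      rw [hA.mem_mball]; exact Or.inr hδ
    rcases le_total 0 x with h | h
    · rw [abs_of_nonneg h] at hm
      exact hx 1 (by simp) hm
    · rw [abs_of_nonpos h] at hm
      apply hx (-1) (by simp)
      have := hA.mball_mul hm (show (-1 : K) ∈ (A : Set K) from A.neg_mem _ A.one_mem)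
      have e : (-x - 1) * -1 = x - -1 := by ring
      rwa [e] at this
  obtain ⟨n, hn⟩ := hN _ hδ
  have hn : |(|x| - 1)⁻¹ / (N : K) ^ n| ≤ 1 := hn
  have hd0 : 0 < |x| - 1 := by linarith
  rw [abs_div, abs_pow, Nat.abs_cast, div_le_one (by positivity), abs_of_pos (by positivity)] at hn
  obtain ⟨M, hM⟩ : ∃ M : ℕ, M = N ^ n := ⟨_, rfl⟩
  have hM0 : (M : K) = N ^ n := by rw [hM]; push_cast; rfl
  rw [← hM0] at hn
  have hMd : 1 ≤ M * (|x| - 1) := by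
    rwa [inv_le_iff_one_le_mul₀ hd0] at hn
  -- `q = 1 + 1/(2M+1)`
  refine ⟨2 * M, ?_⟩
  have hMp : (0 : K) ≤ M := by positivity
  obtain ⟨u, hu⟩ : ∃ u, u = (x / (1 + (((2 * M : ℕ) : K) + 1)⁻¹))⁻¹ := ⟨_, rfl⟩
  have key := tn_ord (A := A) N hN hN0 (x := u * (1 + (((2 * M + 1 : ℕ) : K) + 1)⁻¹)) (by
    have hp1 : (0 : K) < 1 + (((2 * M : ℕ) : K) + 1)⁻¹ := by positivity
    have hp2 : (0 : K) < 1 + (((2 * M + 1 : ℕ) : K) + 1)⁻¹ := by positivity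
    rw [hu, inv_div, abs_mul, abs_div, abs_of_pos hp1, abs_of_pos hp2,
      div_mul_eq_mul_div, div_le_one (by linarith)]
    have e : (1 + (((2 * M : ℕ) : K) + 1)⁻¹) * (1 + (((2 * M + 1 : ℕ) : K) + 1)⁻¹)
        = (2 * M + 3) / (2 * M + 1) := by
      push_cast
      have h1 : (2 * M + 1 : K) ≠ 0 := by positivity
      have h2 : (2 * M + 1 + 1 : K) ≠ 0 := by positivity
      field_simp
      ring
    rw [e, div_le_iff₀ (by positivity)]
    nlinarith) (2 * M + 1)
  have hr : (1 + (((2 * M + 1 : ℕ) : K) + 1)⁻¹) ≠ 0 := by positivity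
  rw [mul_div_cancel_right₀ _ hr] at key
  rwa [← hu]

theorem IsHull.ne_zero {O : Set K} (hO : Loc O) {N : ℕ} (hN : (N : K) ∉ O) : (N : K) ≠ 0 := by
  intro h; rw [h] at hN; exact hN hO.zero

theorem tn_top {O : Set K} (hO : IsLocality O) (hnv : ¬IsValuationLocality O)
    {A : ValuationSubring K} (hA : IsHull O A) (htop : ∀ x, x ∈ A) {y : K} (hy : y ∈ mball O) :
    TN O A y := by
  have hl := hO.loc
  rcases hO with hO | hO | ⟨f, rfl⟩
  · exact absurd hO hnv
  · rcases hA.alt with h | ⟨N, hN, h⟩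
    · exact absurd ⟨A, h⟩ hnv
    have hN0 := IsHull.ne_zero hl hN
    obtain ⟨l, hl, rfl⟩ := ord_linear hO
    exact tn_ord_top N (fun a => h a (htop a)) hN0 hy
  · exact tn_abs f A hy

theorem abs_hull_top {f : AbsoluteValue K ℝ} (hnv : ¬IsValuationLocality {x | f x ≤ 1})
    {A : ValuationSubring K} (hA : IsHull {x | f x ≤ 1} A) (x : K) : x ∈ A := by
  have hN : ∃ N : ℕ, 1 < f N := by
    by_contra hh
    push Not at hh
    exact hnv (abs_bdd_val f hh)
  obtain ⟨N, hN⟩ := hN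
  obtain ⟨n, hn⟩ := pow_unbounded_of_one_lt (f x) hN
  have hN0 : (N : K) ≠ 0 := by
    intro h; rw [h, map_zero] at hN; linarith
  have h1 : x / (N : K) ^ n ∈ A := by
    apply hA.sub
    simp only [Set.mem_ofPred_eq, map_div₀, map_pow]
    rw [div_le_one (by positivity)]
    exact hn.le
  have e : x = x / (N : K) ^ n * (N : K) ^ n := by field_simp
  rw [e]
  exact A.mul_mem _ _ h1 (pow_mem (natCast_mem A N) n)

/-- In the two-orderings case, an element of `O₁` not congruent to one of `O₂`. -/
theorem special_ord {O₁ O₂ : Set K} (h₁ : IsOrderingLocality O₁) (h₂ : IsOrderingLocality O₂)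
    {A : ValuationSubring K} (hA₁ : IsHull O₁ A) (hA₂ : IsHull O₂ A)
    (hnv₁ : ¬IsValuationLocality O₁) (hnv₂ : ¬IsValuationLocality O₂)
    {x : K} (hx : x ∈ O₁) (hne : ∀ y ∈ O₂, x - y ∉ mball (A : Set K)) :
    ∃ b : K, b ≠ 0 ∧ TN O₁ A b ∧ TN O₂ A b⁻¹ := by
  rcases hA₁.alt with h | ⟨N₁, hN₁, hn₁⟩
  · exact absurd ⟨A, h⟩ hnv₁
  rcases hA₂.alt with h | ⟨N₂, hN₂, hn₂⟩
  · exact absurd ⟨A, h⟩ hnv₂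
  have h01 := IsHull.ne_zero (IsLocality.loc (Or.inr (Or.inl h₁))) hN₁
  have h02 := IsHull.ne_zero (IsLocality.loc (Or.inr (Or.inl h₂))) hN₂
  have s2 : ∃ m : ℕ, TN O₂ A (x / (1 + ((m : K) + 1)⁻¹))⁻¹ := by
    obtain ⟨l, hl, rfl⟩ := ord_linear h₂
    exact tn_ord_inv N₂ hn₂ h02 hne
  obtain ⟨m, hm⟩ := s2
  have hx0 : x ≠ 0 := by
    rintro rfl
    apply hne 0 (IsLocality.loc (Or.inr (Or.inl h₂))).zero
    rw [sub_self, (Loc.ofVal A).mem_mball]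
    exact Or.inl rfl
  obtain ⟨l, hl, rfl⟩ := ord_linear h₁
  have hq : (1 + ((m : K) + 1)⁻¹) ≠ 0 := by positivity
  refine ⟨_, div_ne_zero hx0 hq, ?_, hm⟩
  exact tn_ord N₁ hn₁ h01 hx m

theorem special {O₁ O₂ : Set K} (h₁ : IsLocality O₁) (h₂ : IsLocality O₂)
    {A : ValuationSubring K} (hA₁ : IsHull O₁ A) (hA₂ : IsHull O₂ A)
    (hnv₁ : ¬IsValuationLocality O₁) (hnv₂ : ¬IsValuationLocality O₂) (hinc : Incomp O₁ O₂)
    (hst : IsOrderingLocality O₁ → IsOrderingLocality O₂ → ¬SameResidue (A : Set K) O₁ O₂) :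
    ∃ b : K, b ≠ 0 ∧ TN O₁ A b ∧ TN O₂ A b⁻¹ := by
  have l1 := h₁.loc
  have l2 := h₂.loc
  by_cases htop : ∀ x, x ∈ A
  · obtain ⟨x, hx1, hx2⟩ := Set.not_subset.1 hinc.1
    obtain ⟨y, hy2, hy1⟩ := Set.not_subset.1 hinc.2
    have hx0 : x ≠ 0 := by rintro rfl; exact hx2 l2.zero
    have hy0 : y ≠ 0 := by rintro rfl; exact hy1 l1.zero
    refine ⟨y⁻¹ * x, mul_ne_zero (inv_ne_zero hy0) hx0, tn_top h₁ hnv₁ hA₁ htop (l1.mball_mul (l1.inv_mball hy1) hx1),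
      tn_top h₂ hnv₂ hA₂ htop ?_⟩
    rw [mul_inv, inv_inv, mul_comm]
    exact l2.mball_mul (l2.inv_mball hx2) hy2
  · have o1 : IsOrderingLocality O₁ := by
      rcases h₁ with h | h | ⟨f, rfl⟩
      · exact absurd h hnv₁
      · exact h
      · exact absurd (abs_hull_top hnv₁ hA₁) htop
    have o2 : IsOrderingLocality O₂ := by
      rcases h₂ with h | h | ⟨f, rfl⟩
      · exact absurd h hnv₂
      · exact h
      · exact absurd (abs_hull_top hnv₂ hA₂) htop
    have hh := hst o1 o2
    unfold SameResidue at hh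
    rw [not_and_or] at hh
    rcases hh with hh | hh
    · push Not at hh
      obtain ⟨x, hx, hne⟩ := hh
      exact special_ord o1 o2 hA₁ hA₂ hnv₁ hnv₂ hx hne
    · push Not at hh
      obtain ⟨y, hy, hne⟩ := hh
      obtain ⟨b, hb0, hb2, hb1⟩ := special_ord o2 o1 hA₂ hA₁ hnv₂ hnv₁ hy (fun x hx hm => by
        apply hne x hx
        have := (Loc.ofVal A).mball_mul hm (show (-1 : K) ∈ (A : Set K) from A.neg_mem _ A.one_mem)
        have e : (y - x) * -1 = x - y := by ring
        rwa [e] at this)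
      exact ⟨b⁻¹, inv_ne_zero hb0, hb1, by rwa [inv_inv]⟩

theorem prod_right {O : Set K} (hO : Loc O) {A B : ValuationSubring K} (hB : IsHull O B) {x : K}
    (hx : x ∈ prodVal A B) : ∃ a ∈ (A : Set K), ∃ u ∈ O, x = a * u := by
  obtain ⟨a, ha, b, hb, rfl⟩ := hx
  rcases hB.alt with h | ⟨N, hN, h⟩
  · exact ⟨a, ha, b, by rw [h]; exact hb, rfl⟩
  · obtain ⟨n, hn⟩ := h b hb
    have h0 := IsHull.ne_zero hO hN
    exact ⟨a * (N : K) ^ n, A.mul_mem _ _ ha (pow_mem (natCast_mem A N) n), _, hn,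
      by field_simp⟩

theorem prod_left {O : Set K} (hO : Loc O) {A B : ValuationSubring K} (hA : IsHull O A) {x : K}
    (hx : x ∈ prodVal A B) : ∃ u ∈ O, ∃ b ∈ (B : Set K), x = u * b := by
  obtain ⟨a, ha, b, hb, rfl⟩ := hx
  obtain ⟨c, hc, u, hu, e⟩ := prod_right (A := B) hO hA
    (show b * a ∈ prodVal B A from ⟨b, hb, a, ha, rfl⟩)
  exact ⟨u, hu, c, hc, by rw [mul_comm a b, e, mul_comm]⟩

theorem pair_core {t : K} {O₁ O₂ : Set K} (h₁ : IsLocality O₁) (h₂ : IsLocality O₂)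
    (hinc : Incomp O₁ O₂) (hti : TIndep t O₁ O₂) {A B : ValuationSubring K}
    (hA : IsHull O₁ A) (hB : IsHull O₂ B) {s s' : K} (hs : s ∈ prodVal A B)
    (hs' : s' ∈ prodVal A B) :
    ∃ b : K, b ≠ 0 ∧ b * s ∈ mball O₁ ∧ b⁻¹ * s' ∈ mball O₂ := by
  have l1 := h₁.loc
  have l2 := h₂.loc
  have lA := Loc.ofVal A
  have lB := Loc.ofVal B
  by_cases c1 : O₂ ⊆ A
  swap
  · obtain ⟨b, hb0, hb1, hb2⟩ := pair_generic lA l2 ⟨fun h => hinc.1 (hA.sub.trans h), c1⟩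
      (prod_right l2 hB hs) (prod_right l2 hB hs')
    exact ⟨b, hb0, l1.mball_mono lA hA.sub hb1, hb2⟩
  by_cases c2 : O₁ ⊆ B
  swap
  · obtain ⟨b, hb0, hb1, hb2⟩ := pair_generic l1 lB ⟨c2, fun h => hinc.2 (hB.sub.trans h)⟩
      (prod_left l1 hA hs) (prod_left l1 hA hs')
    exact ⟨b, hb0, hb1, l2.mball_mono lB hB.sub hb2⟩
  have hAB : A = B := le_antisymm (hA.min l1 c2) (hB.min l2 c1)
  subst hAB
  have hnv₁ : ¬IsValuationLocality O₁ := by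
    rintro ⟨C, hC⟩
    have := hA.min l1 hC.subset
    exact hinc.2 (fun x hx => by rw [hC]; exact this (c1 hx))
  have hnv₂ : ¬IsValuationLocality O₂ := by
    rintro ⟨C, hC⟩
    have := hB.min l2 hC.subset
    exact hinc.1 (fun x hx => by rw [hC]; exact this (c2 hx))
  have hprod : prodVal A A = A := by
    apply le_antisymm
    · rintro x ⟨a, ha, b, hb, rfl⟩
      exact A.mul_mem _ _ ha hb
    · exact le_prodVal_left A A
  have hfcc := fcc_prodVal h₁ h₂ hinc hA hB
  rw [hprod] at hs hs' hfcc
  obtain ⟨b, hb0, hb1, hb2⟩ := special h₁ h₂ hA hB hnv₁ hnv₂ hinc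
    (fun o1 o2 => (hti.2 o1 o2).2 _ hfcc)
  obtain ⟨k, hk⟩ := hb1 s hs
  obtain ⟨k', hk'⟩ := hb2 s' hs'
  refine ⟨b ^ (max k k'), pow_ne_zero _ hb0, hk _ (le_max_left _ _), ?_⟩
  rw [← inv_pow]
  exact hk' _ (le_max_right _ _)

/-- The pairwise version of the main statement. -/
theorem pair_main {t z z' : K} (ht : t ≠ 0) (hz : z ≠ 0) (hz' : z' ≠ 0) {O₁ O₂ : Set K}
    (h₁ : IsLocality O₁) (h₂ : IsLocality O₂)
    (hinc : Incomp O₁ O₂) (hti : TIndep t O₁ O₂)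
    (hzz : ∀ W : Set K, IsValuationLocality W → O₁ ⊆ W → O₂ ⊆ W → z⁻¹ ∈ W ∧ z'⁻¹ ∈ W) :
    ∃ b : K, b ≠ 0 ∧ (b * t⁻¹ ∈ mball O₁ ∧ b * (t * z)⁻¹ ∈ mball O₁) ∧
      (b⁻¹ * t⁻¹ ∈ mball O₂ ∧ b⁻¹ * (t * z')⁻¹ ∈ mball O₂) := by
  obtain ⟨A, hA⟩ := hull_exists h₁
  obtain ⟨B, hB⟩ := hull_exists h₂
  have hfcc := fcc_prodVal h₁ h₂ hinc hA hB
  have htW := (hti.1 _ hfcc).2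
  obtain ⟨hzW, hzW'⟩ := hzz _ ⟨_, rfl⟩ hfcc.2.1 hfcc.2.2.1
  -- choose the larger of two elements
  have dom : ∀ O : Set K, Loc O → ∀ z : K, z ≠ 0 → z⁻¹ ∈ prodVal A B →
      ∃ s ∈ prodVal A B, ∀ b : K, b * s ∈ mball O →
        b * t⁻¹ ∈ mball O ∧ b * (t * z)⁻¹ ∈ mball O := by
    intro O hO z hz hzW
    by_cases hzO : z⁻¹ ∈ O
    · refine ⟨t⁻¹, htW, fun b hb => ⟨hb, ?_⟩⟩
      rw [mul_inv, ← mul_assoc]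
      exact hO.mball_mul hb hzO
    · have hzO' := hO.tot _ hzO
      rw [inv_inv] at hzO'
      refine ⟨t⁻¹ * z⁻¹, (prodVal A B).mul_mem _ _ htW hzW, fun b hb => ⟨?_, by rwa [mul_inv]⟩⟩
      have := hO.mball_mul hb hzO'
      have e : b * (t⁻¹ * z⁻¹) * z = b * t⁻¹ := by field_simp
      rwa [e] at this
  obtain ⟨s, hs, hsb⟩ := dom O₁ h₁.loc z hz hzW
  obtain ⟨s', hs', hsb'⟩ := dom O₂ h₂.loc z' hz' hzW'
  obtain ⟨b, hb0, hb1, hb2⟩ := pair_core h₁ h₂ hinc hti hA hB hs hs'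
  exact ⟨b, hb0, hsb _ hb1, hsb' _ hb2⟩

theorem condIV_mem {t : K} (ht : t ≠ 0) {O : Set K} (hO : Loc O) (h : CondIV t O) : t ∈ O := by
  have := h 1 hO.one 0 hO.zero
  rw [mem_scale_iff (inv_ne_zero ht)] at this
  simpa using this

/-- The homogenized polynomial behaves like `max(x, y)^d` up to `t`. -/
theorem combine {t : K} (ht : t ≠ 0) {O : Set K} (hO : Loc O) {f : Polynomial K}
    (h1 : CondI f O) (h2 : CondII t f O) (h3 : CondIII t f O)
    {x y : K} (hx : x ≠ 0) (hy : y ≠ 0) :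
    ∃ M u : K, (M = x ∨ M = y) ∧ x * M⁻¹ ∈ O ∧ y * M⁻¹ ∈ O ∧ u ≠ 0 ∧ u ∈ O ∧ t * u⁻¹ ∈ O ∧
      y ^ f.natDegree * f.eval (x * y⁻¹) = M ^ f.natDegree * u := by
  have hu : ∀ u, u ∉ scale t (mball O) → u ≠ 0 ∧ t * u⁻¹ ∈ O := by
    intro u hu
    rw [mem_scale_iff ht, hO.mem_mball] at hu
    push Not at hu
    obtain ⟨ha, hb⟩ := hu
    refine ⟨?_, ?_⟩
    · rintro rfl; simp at ha
    · rwa [mul_inv, inv_inv, mul_comm] at hb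
  by_cases hxy : x * y⁻¹ ∈ O
  · obtain ⟨a, b⟩ := hu _ (h2 _ hxy)
    exact ⟨y, _, Or.inr rfl, hxy, by rw [mul_inv_cancel₀ hy]; exact hO.one, a, h1 _ hxy, b, rfl⟩
  · obtain ⟨u, ⟨hu1, hu2⟩, he⟩ := (h3 _ hxy).1
    obtain ⟨a, b⟩ := hu _ hu2
    refine ⟨x, u, Or.inl rfl, by rw [mul_inv_cancel₀ hx]; exact hO.one, ?_, a, hu1, b, ?_⟩
    · have := hO.tot _ hxy
      rwa [mul_inv, inv_inv, mul_comm] at this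
    · rw [he, mul_pow, inv_pow]
      field_simp

theorem combine_small {t : K} {O : Set K} (hO : Loc O) (htO : t ∈ O) (ht : t ≠ 0) {M u s : K}
    {d : ℕ} (hd : 2 ≤ d) (hu : u ∈ O) (hM : M * t⁻¹ ∈ mball O) (hMs : M * s ∈ mball O) :
    M ^ d * u * s ∈ mball O := by
  have hMO : M ∈ O := by
    have := mball_sub (hO.mball_mul hM htO)
    rwa [mul_assoc, inv_mul_cancel₀ ht, mul_one] at this
  obtain ⟨e, rfl⟩ : ∃ e, d = e + 1 := ⟨d - 1, by omega⟩
  have : M ^ (e + 1) * u * s = M * s * (M ^ e * u) := by ring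
  rw [this]
  exact hO.mball_mul hMs (hO.mul _ (hO.pow hMO e) _ hu)

theorem combine_big {t : K} {O : Set K} (hO : Loc O) (htO : t ∈ O) (ht : t ≠ 0) {M u s x : K}
    {d : ℕ} (hd : 2 ≤ d) (hx0 : x ≠ 0) (hM0 : M ≠ 0) (hu : t * u⁻¹ ∈ O) (hxM : x * M⁻¹ ∈ O)
    (hx : x⁻¹ * t⁻¹ ∈ mball O) (hxs : x⁻¹ * s ∈ mball O) :
    (M ^ d * u)⁻¹ * s ∈ mball O := by
  have hMt : M⁻¹ * t⁻¹ ∈ O := by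
    have := mball_sub (hO.mball_mul hx hxM)
    have e : x⁻¹ * t⁻¹ * (x * M⁻¹) = M⁻¹ * t⁻¹ := by field_simp
    rwa [e] at this
  have hMO : M⁻¹ ∈ O := by
    have := hO.mul _ hMt _ htO
    rwa [mul_assoc, inv_mul_cancel₀ ht, mul_one] at this
  have hMs : M⁻¹ * s ∈ mball O := by
    have := hO.mball_mul hxs hxM
    have e : x⁻¹ * s * (x * M⁻¹) = M⁻¹ * s := by field_simp
    rwa [e] at this
  obtain ⟨e, rfl⟩ : ∃ e, d = e + 2 := ⟨d - 2, by omega⟩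
  have : (M ^ (e + 2) * u)⁻¹ * s = M⁻¹ * s * ((M⁻¹ * t⁻¹) * ((M⁻¹) ^ e * (t * u⁻¹))) := by
    rw [mul_inv, pow_add, inv_pow]
    field_simp
  rw [this]
  exact hO.mball_mul hMs (hO.mul _ hMt _ (hO.mul _ (hO.pow hMO e) _ hu))

/-- Compactness step. -/
theorem compact_step {t : K} (ht : t ≠ 0) {S : Set (Set K)} (hSloc : ∀ v ∈ S, IsLocality v)
    (hU : AssumptionU S t) {V T : Set (Set K)} (hV : V ⊆ S) (hT : T ⊆ S) (hTne : T.Nonempty)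
    (hc : @IsCompact (Set K) (zarStarTop K) T) (s s' : K)
    (h : ∀ w ∈ T, ∃ b : K, b ≠ 0 ∧ (∀ v ∈ V, b * t⁻¹ ∈ mball v ∧ b * s ∈ mball v) ∧
      (b⁻¹ * t⁻¹ ∈ mball w ∧ b⁻¹ * s' ∈ mball w)) :
    ∃ b : K, b ≠ 0 ∧ (∀ v ∈ V, b * t⁻¹ ∈ mball v ∧ b * s ∈ mball v) ∧
      ∀ w ∈ T, (b⁻¹ * t⁻¹ ∈ mball w ∧ b⁻¹ * s' ∈ mball w) := by
  obtain ⟨f, hd, hf⟩ := hU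
  letI : TopologicalSpace (Set K) := zarStarTop K
  have hopen : ∀ x : K, IsOpen {O : Set K | x ∈ mball O} := fun x =>
    TopologicalSpace.isOpen_generateFrom_of_mem ⟨x, rfl⟩
  have main : ∃ b : K, b ≠ 0 ∧ (∀ v ∈ V, b * t⁻¹ ∈ mball v ∧ b * s ∈ mball v) ∧
      ∀ w ∈ T ∩ T, (b⁻¹ * t⁻¹ ∈ mball w ∧ b⁻¹ * s' ∈ mball w) := by
    refine hc.induction_on (p := fun R : Set (Set K) => ∃ b : K, b ≠ 0 ∧
      (∀ v ∈ V, b * t⁻¹ ∈ mball v ∧ b * s ∈ mball v) ∧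
      ∀ w ∈ R ∩ T, (b⁻¹ * t⁻¹ ∈ mball w ∧ b⁻¹ * s' ∈ mball w)) ?_ ?_ ?_ ?_
    · obtain ⟨w, hw⟩ := hTne
      obtain ⟨b, hb0, hb, _⟩ := h w hw
      exact ⟨b, hb0, hb, fun w hw => absurd hw.1 (Set.notMem_empty _)⟩
    · rintro R R' hRR ⟨b, hb0, hb, hb'⟩
      exact ⟨b, hb0, hb, fun w hw => hb' w ⟨hRR hw.1, hw.2⟩⟩
    · rintro R R' ⟨x, hx0, hx, hx'⟩ ⟨y, hy0, hy, hy'⟩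
      refine ⟨y ^ f.natDegree * f.eval (x * y⁻¹), ?_, ?_, ?_⟩
      · obtain ⟨w, hw⟩ := hTne
        obtain ⟨f1, f2, f3, f4⟩ := hf w (hT hw)
        obtain ⟨M, u, hM, -, -, hu0, -, -, e⟩ := combine ht (hSloc w (hT hw)).loc f1 f2 f3 hx0 hy0
        rw [e]
        refine mul_ne_zero (pow_ne_zero _ ?_) hu0
        rcases hM with rfl | rfl <;> assumption
      · intro v hv
        have hO := (hSloc v (hV hv)).loc
        obtain ⟨f1, f2, f3, f4⟩ := hf v (hV hv)
        have htO := condIV_mem ht hO f4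
        obtain ⟨M, u, hM, -, -, hu0, hu, -, e⟩ := combine ht hO f1 f2 f3 hx0 hy0
        rw [e]
        have hMv : M * t⁻¹ ∈ mball v ∧ M * s ∈ mball v := by
          rcases hM with rfl | rfl
          · exact hx v hv
          · exact hy v hv
        exact ⟨combine_small hO htO ht hd hu hMv.1 hMv.1,
          combine_small hO htO ht hd hu hMv.1 hMv.2⟩
      · rintro w ⟨hwR, hw⟩
        have hO := (hSloc w (hT hw)).loc
        obtain ⟨f1, f2, f3, f4⟩ := hf w (hT hw)
        have htO := condIV_mem ht hO f4
        obtain ⟨M, u, hM, hxM, hyM, hu0, -, hu, e⟩ := combine ht hO f1 f2 f3 hx0 hy0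
        rw [e]
        have hM0 : M ≠ 0 := by rcases hM with rfl | rfl <;> assumption
        rcases hwR with hwR | hwR
        · have := hx' w ⟨hwR, hw⟩
          exact ⟨combine_big hO htO ht hd hx0 hM0 hu hxM this.1 this.1,
            combine_big hO htO ht hd hx0 hM0 hu hxM this.1 this.2⟩
        · have := hy' w ⟨hwR, hw⟩
          exact ⟨combine_big hO htO ht hd hy0 hM0 hu hyM this.1 this.1,
            combine_big hO htO ht hd hy0 hM0 hu hyM this.1 this.2⟩
    · intro w hw
      obtain ⟨b, hb0, hb, hb'⟩ := h w hw
      refine ⟨{O : Set K | b⁻¹ * t⁻¹ ∈ mball O} ∩ {O : Set K | b⁻¹ * s' ∈ mball O},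
        mem_nhdsWithin_of_mem_nhds (((hopen _).inter (hopen _)).mem_nhds hb'), b, hb0, hb,
        fun w hw => hw.1⟩
  simpa only [Set.inter_self] using main

/-- **Lemma 4.2**: construction of a `b ∈ K^×` which is uniformly small on `S₁` and
uniformly big on `S₂`. -/
theorem uniform_indicator {K : Type*} [Field K] (t : K) (ht : t ≠ 0)
    (S : Set (Set K)) (hSloc : ∀ v ∈ S, IsLocality v) (hU : AssumptionU S t)
    (S₁ S₂ : Set (Set K)) (hsub₁ : S₁ ⊆ S) (hsub₂ : S₂ ⊆ S)
    (hne₁ : S₁.Nonempty) (hne₂ : S₂.Nonempty)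
    (hcpt₁ : @IsCompact (Set K) (zarStarTop K) S₁) (hcpt₂ : @IsCompact (Set K) (zarStarTop K) S₂)
    (hti : SetTIndep t S₁ S₂) (hinc : SetIncomp S₁ S₂)
    (z z' : K) (hz : z ≠ 0) (hz' : z' ≠ 0)
    (hzz : ∀ W : Set K, IsValuationLocality W → (∃ v ∈ S₁, v ⊆ W) → (∃ v ∈ S₂, v ⊆ W) →
      z⁻¹ ∈ W ∧ z'⁻¹ ∈ W) :
    ∃ b : K, b ≠ 0 ∧
      (∀ v ∈ S₁, b ∈ scale t (mball v) ∩ scale (t * z) (mball v)) ∧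
      ∀ v ∈ S₂, b⁻¹ ∈ scale t (mball v) ∩ scale (t * z') (mball v) := by
  have step1 : ∀ v ∈ S₁, ∃ b : K, b ≠ 0 ∧
      (∀ w ∈ S₂, b * t⁻¹ ∈ mball w ∧ b * (t * z')⁻¹ ∈ mball w) ∧
      (b⁻¹ * t⁻¹ ∈ mball v ∧ b⁻¹ * (t * z)⁻¹ ∈ mball v) := by
    intro v hv
    obtain ⟨b, hb0, hb1, hb2⟩ := compact_step ht hSloc hU (V := {v}) (T := S₂)
      (by simpa using hsub₁ hv) hsub₂ hne₂ hcpt₂ (t * z)⁻¹ (t * z')⁻¹ (fun w hw => by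
        obtain ⟨b, hb0, hb1, hb2⟩ := pair_main ht hz hz' (hSloc v (hsub₁ hv))
          (hSloc w (hsub₂ hw)) (hinc v hv w hw) (hti v hv w hw)
          (fun W hW hvW hwW => hzz W hW ⟨v, hv, hvW⟩ ⟨w, hw, hwW⟩)
        exact ⟨b, hb0, fun v' hv' => by rw [Set.mem_singleton_iff.1 hv']; exact hb1, hb2⟩)
    refine ⟨b⁻¹, inv_ne_zero hb0, hb2, ?_⟩
    rw [inv_inv]
    exact hb1 v rfl
  obtain ⟨b, hb0, hb1, hb2⟩ := compact_step ht hSloc hU hsub₂ hsub₁ hne₁ hcpt₁ _ _ step1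
  refine ⟨b⁻¹, inv_ne_zero hb0, fun v hv => ?_, fun v hv => ?_⟩
  · exact ⟨(mem_scale_iff ht).2 (hb2 v hv).1, (mem_scale_iff (mul_ne_zero ht hz)).2 (hb2 v hv).2⟩
  · rw [inv_inv]
    exact ⟨(mem_scale_iff ht).2 (hb1 v hv).1, (mem_scale_iff (mul_ne_zero ht hz')).2 (hb1 v hv).2⟩

end PaperApprox
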